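/- For all integers n ≥ 2 and 1 ≤ r ≤ n/2 − 1, Γ_B^(n)(2^{n−2}, r) = C(n−2,≤r) / (4·C(n,≤r)); that is, the maximum ball-noise stability of a Boolean function with exactly 2^{n−2} ones equals C(n−2,≤r)/(4·C(n,≤r)), attained by a subcube. -/

import Mathlib

open Finset

noncomputable section

/-- The Hamming ball of radius `r` around the all-ones vector in `{-1,1}^n`
(vertices modeled as `Fin n → ℤˣ`, where `ℤˣ = {1, -1}`). -/
def hBall (n r : ℕ) : Finset (Fin n → ℤˣ) :=
  Finset.univ.filter fun z => hammingDist z 1 ≤ r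

/-- The Hamming sphere of radius `r` around the all-ones vector. -/
def hSphere (n r : ℕ) : Finset (Fin n → ℤˣ) :=
  Finset.univ.filter fun z => hammingDist z 1 = r

/-- Ball-noise stability `E[f(X) f(X∘Z)]`, `X` uniform on the cube, `Z` uniform on `B_r`. -/
def BStab (n r : ℕ) (f : (Fin n → ℤˣ) → ℝ) : ℝ :=
  (∑ x : Fin n → ℤˣ, ∑ z ∈ hBall n r, f x * f (x * z)) / (2 ^ n * (hBall n r).card)

/-- Sphere-noise stability `E[f(X) f(X∘Z)]`, `X` uniform on the cube, `Z` uniform on `S_r`. -/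
def SStab (n r : ℕ) (f : (Fin n → ℤˣ) → ℝ) : ℝ :=
  (∑ x : Fin n → ℤˣ, ∑ z ∈ hSphere n r, f x * f (x * z)) / (2 ^ n * (hSphere n r).card)

/-- i.i.d.-noise stability `E[f(X) f(X∘Z)]`, `Z` with i.i.d. coordinates equal to `-1`
with probability `β` and `1` with probability `1-β`. -/
def Stab (n : ℕ) (β : ℝ) (f : (Fin n → ℤˣ) → ℝ) : ℝ :=
  (∑ x : Fin n → ℤˣ, ∑ z : Fin n → ℤˣ,
      (∏ i, if z i = 1 then 1 - β else β) * (f x * f (x * z))) / 2 ^ n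

/-- Indicator function of a set `A` of vertices. -/
def indic (n : ℕ) (A : Finset (Fin n → ℤˣ)) : (Fin n → ℤˣ) → ℝ :=
  fun x => if x ∈ A then 1 else 0

/-- `Γ_B^(n)(M,r)`: maximal ball-noise stability over Boolean functions with exactly `M` ones. -/
def GammaB (n M r : ℕ) : ℝ :=
  sSup {y | ∃ A : Finset (Fin n → ℤˣ), A.card = M ∧ y = BStab n r (indic n A)}

/-- `Γ_S^(n)(M,r)`: maximal sphere-noise stability over Boolean functions with exactly `M` ones. -/
def GammaS (n M r : ℕ) : ℝ :=
  sSup {y | ∃ A : Finset (Fin n → ℤˣ), A.card = M ∧ y = SStab n r (indic n A)}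

/-- `Γ_IID^(n)(M,β)`: maximal i.i.d.-noise stability over Boolean functions with exactly `M` ones. -/
def GammaIID (n M : ℕ) (β : ℝ) : ℝ :=
  sSup {y | ∃ A : Finset (Fin n → ℤˣ), A.card = M ∧ y = Stab n β (indic n A)}

/-- `Γ_IID(α,β) := sup_n Γ_IID^(n)(⌊α·2^n⌋, β)` (equivalently the limit, by monotonicity). -/
def GammaIIDlim (α β : ℝ) : ℝ := ⨆ n : ℕ, GammaIID n ⌊α * 2 ^ n⌋₊ β

/-- `C(n, ≤ r) = Σ_{i=0}^r C(n,i)`. -/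
def ballBinom (n r : ℕ) : ℕ := ∑ i ∈ Finset.range (r + 1), n.choose i

/-- The Krawtchouk number: the coefficient of `X ^ r` in `(1 - X) ^ a * (1 + X) ^ b`. -/
def krawtchouk (a b r : ℕ) : ℤ :=
  ((1 - Polynomial.X) ^ a * (1 + Polynomial.X) ^ b : Polynomial ℤ).coeff r

lemma krawtchouk_zero (a b : ℕ) : krawtchouk a b 0 = 1 := by
  simp [krawtchouk, Polynomial.coeff_zero_eq_eval_zero]

lemma krawtchouk_succ_right (a b r : ℕ) :
    krawtchouk a (b + 1) (r + 1) = krawtchouk a b (r + 1) + krawtchouk a b r := by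
  have h : ((1 - Polynomial.X) ^ a * (1 + Polynomial.X) ^ (b + 1) : Polynomial ℤ) =
      (1 - Polynomial.X) ^ a * (1 + Polynomial.X) ^ b +
        (1 - Polynomial.X) ^ a * (1 + Polynomial.X) ^ b * Polynomial.X := by ring
  rw [krawtchouk, h, Polynomial.coeff_add, Polynomial.coeff_mul_X]
  rfl

lemma krawtchouk_succ_left (a b r : ℕ) :
    krawtchouk (a + 1) b (r + 1) = krawtchouk a b (r + 1) - krawtchouk a b r := by
  have h : ((1 - Polynomial.X) ^ (a + 1) * (1 + Polynomial.X) ^ b : Polynomial ℤ) =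
      (1 - Polynomial.X) ^ a * (1 + Polynomial.X) ^ b -
        (1 - Polynomial.X) ^ a * (1 + Polynomial.X) ^ b * Polynomial.X := by ring
  rw [krawtchouk, h, Polynomial.coeff_sub, Polynomial.coeff_mul_X]
  rfl

lemma krawtchouk_zero_left (b r : ℕ) : krawtchouk 0 b r = b.choose r := by
  simp [krawtchouk, Polynomial.coeff_one_add_X_pow]

lemma krawtchouk_zero_zero_succ (r : ℕ) : krawtchouk 0 0 (r + 1) = 0 := by
  simp [krawtchouk_zero_left]

lemma krawtchouk_swap (a b r : ℕ) : krawtchouk b a r = (-1) ^ r * krawtchouk a b r := by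
  induction a generalizing r with
  | zero =>
    induction b generalizing r with
    | zero => cases r <;> simp [krawtchouk_zero, krawtchouk_zero_zero_succ]
    | succ b ih =>
      cases r with
      | zero => simp [krawtchouk_zero]
      | succ r => rw [krawtchouk_succ_left, krawtchouk_succ_right, ih, ih]; ring
  | succ a ih =>
    cases r with
    | zero => simp [krawtchouk_zero]
    | succ r => rw [krawtchouk_succ_left, krawtchouk_succ_right, ih, ih]; ring

lemma krawtchouk_eq_zero_of_lt (a b r : ℕ) (h : a + b < r) : krawtchouk a b r = 0 := by
  induction a generalizing r with
  | zero => simp [krawtchouk_zero_left, Nat.choose_eq_zero_of_lt (by omega : b < r)]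
  | succ a ih =>
    obtain ⟨r, rfl⟩ : ∃ s, r = s + 1 := ⟨r - 1, by omega⟩
    rw [krawtchouk_succ_left, ih _ (by omega), ih _ (by omega), sub_zero]

lemma krawtchouk_reflect (a b r s : ℕ) (h : r + s = a + b) :
    krawtchouk a b s = (-1) ^ a * krawtchouk a b r := by
  induction a generalizing r s with
  | zero =>
    rw [krawtchouk_zero_left, krawtchouk_zero_left,
      Nat.choose_symm_of_eq_add (by omega : b = r + s)]
    simp
  | succ a ih =>
    cases r with
    | zero =>
      obtain rfl : s = a + b + 1 := by omega
      rw [krawtchouk_succ_left, krawtchouk_eq_zero_of_lt a b (a + b + 1) (by omega),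
        ih 0 (a + b) (by omega), krawtchouk_zero, krawtchouk_zero]
      ring
    | succ r =>
      cases s with
      | zero =>
        obtain rfl : r = a + b := by omega
        rw [krawtchouk_succ_left, krawtchouk_eq_zero_of_lt a b (a + b + 1) (by omega),
          krawtchouk_zero]
        have h1 := ih (a + b) 0 (by omega)
        rw [krawtchouk_zero] at h1
        rw [pow_succ]
        linarith
      | succ s =>
        rw [krawtchouk_succ_left, krawtchouk_succ_left, ih (r + 1) s (by omega),
          ih r (s + 1) (by omega)]
        ring

lemma krawtchouk_one (a b : ℕ) : krawtchouk a b 1 = b - a := by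
  induction a with
  | zero => simp [krawtchouk_zero_left]
  | succ a ih =>
    rw [show (1 : ℕ) = 0 + 1 from rfl, krawtchouk_succ_left, krawtchouk_zero]
    simp only [zero_add, ih]
    push_cast
    ring

lemma krawtchouk_middle_eq_zero (a b r : ℕ) (h : a + b = 2 * r) (ha : Odd a) :
    krawtchouk a b r = 0 := by
  have := krawtchouk_reflect a b r r (by omega)
  rw [ha.neg_one_pow] at this
  linarith

lemma sum_krawtchouk_succ_left (a b r : ℕ) :
    ∑ i ∈ range (r + 1), krawtchouk (a + 1) b i = krawtchouk a b r := by
  induction r with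
  | zero => simp [krawtchouk_zero]
  | succ r ih => rw [sum_range_succ, ih, krawtchouk_succ_left]; ring

lemma abs_krawtchouk_le (m r : ℕ) (hr : 2 * r + 1 ≤ m) (a b : ℕ) (hab : a + b = m)
    (ha : 1 ≤ a) (hb : 1 ≤ b) : |krawtchouk a b r| ≤ krawtchouk 1 (m - 1) r := by
  induction m generalizing r a b with
  | zero => omega
  | succ m ih =>
    cases r with
    | zero => simp [krawtchouk_zero]
    | succ r =>
      obtain ⟨l, rfl⟩ : ∃ l, m = l + 1 := ⟨m - 1, by omega⟩
      simp only [add_tsub_cancel_right] at ih ⊢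
      rw [krawtchouk_succ_right]
      by_cases hlast : 2 * (r + 1) = l + 1
      · rw [krawtchouk_middle_eq_zero 1 l (r + 1) (by omega) odd_one, zero_add]
        rcases Nat.even_or_odd a with he | ho
        · have ha2 : 2 ≤ a := by
            rcases he with ⟨c, hc⟩
            omega
          obtain ⟨a, rfl⟩ : ∃ c, a = c + 1 := ⟨a - 1, by omega⟩
          rw [krawtchouk_succ_left, krawtchouk_middle_eq_zero a b (r + 1) (by omega)
            (by simpa [Nat.even_add_one] using he), zero_sub, abs_neg]
          exact ih r (by omega) a b (by omega) (by omega) hb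
        · have hb2 : 2 ≤ b := by
            rcases ho with ⟨c, hc⟩
            omega
          obtain ⟨b, rfl⟩ : ∃ c, b = c + 1 := ⟨b - 1, by omega⟩
          rw [krawtchouk_succ_right, krawtchouk_middle_eq_zero a b (r + 1) (by omega) ho, zero_add]
          exact ih r (by omega) a b (by omega) ha (by omega)
      · have key : ∀ c, ∀ d, c + d = l + 1 → 1 ≤ c → 1 ≤ d →
            |krawtchouk c (d + 1) (r + 1)| ≤ krawtchouk 1 l (r + 1) + krawtchouk 1 l r := by
          intro c d hcd hc hd
          rw [krawtchouk_succ_right]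
          exact (abs_add_le _ _).trans (add_le_add (ih (r + 1) (by omega) c d hcd hc hd)
            (ih r (by omega) c d hcd hc hd))
        by_cases hb1 : b = 1
        · subst hb1
          obtain ⟨a, rfl⟩ : ∃ c, a = c + 1 := ⟨a - 1, by omega⟩
          rw [krawtchouk_swap 1 (a + 1), abs_mul, abs_pow, abs_neg, abs_one, one_pow, one_mul]
          exact key 1 a (by omega) le_rfl (by omega)
        · obtain ⟨b, rfl⟩ : ∃ c, b = c + 1 := ⟨b - 1, by omega⟩
          exact key a b (by omega) ha (by omega)

lemma krawtchouk_subcube (m i : ℕ) :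
    krawtchouk 0 (m + 2) i + 2 * krawtchouk 1 (m + 1) i + krawtchouk 2 m i = 4 * m.choose i := by
  rw [← krawtchouk_zero_left]
  simp only [krawtchouk, two_mul, ← Polynomial.coeff_add]
  rw [show (4 : ℤ) = ((4 : ℕ) : ℤ) from rfl, ← nsmul_eq_mul, ← Polynomial.coeff_smul]
  congr 1
  rw [nsmul_eq_mul]
  push_cast
  ring

/-- The Walsh character of the cube indexed by `S`. -/
def walsh {n : ℕ} (S : Finset (Fin n)) (x : Fin n → ℤˣ) : ℤ := ∏ i ∈ S, (x i : ℤ)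

/-- The squared (unnormalized) Walsh coefficient at `S` of the indicator of `A`. -/
def walshWeight {n : ℕ} (A : Finset (Fin n → ℤˣ)) (S : Finset (Fin n)) : ℤ :=
  (∑ x ∈ A, walsh S x) ^ 2

/-- The number of pairs in `A` whose quotient lies in `B`. -/
def pairCount {n : ℕ} (A B : Finset (Fin n → ℤˣ)) : ℤ :=
  ∑ x ∈ A, ∑ y ∈ A, if x * y ∈ B then 1 else 0

lemma pairCount_nonneg {n : ℕ} (A B : Finset (Fin n → ℤˣ)) : 0 ≤ pairCount A B :=
  sum_nonneg fun _ _ => sum_nonneg fun _ _ => by split_ifs <;> simp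

lemma walsh_mul {n : ℕ} (S : Finset (Fin n)) (x y : Fin n → ℤˣ) :
    walsh S (x * y) = walsh S x * walsh S y := by
  simp [walsh, prod_mul_distrib]

lemma cube_mul_self {n : ℕ} (x : Fin n → ℤˣ) : x * x = 1 := by
  ext i
  simp

lemma sum_walsh_index {n : ℕ} (z : Fin n → ℤˣ) :
    ∑ S : Finset (Fin n), walsh S z = if z = 1 then 2 ^ n else 0 := by
  have h : ∑ S : Finset (Fin n), walsh S z = ∏ i, (1 + (z i : ℤ)) := by
    rw [prod_one_add, powerset_univ]
    rfl
  rw [h]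
  split_ifs with hz
  · norm_num [hz]
  · obtain ⟨i, hi⟩ := Function.ne_iff.mp hz
    refine prod_eq_zero (mem_univ i) ?_
    rcases Int.units_eq_one_or (z i) with h1 | h1
    · exact absurd h1 hi
    · simp [h1]

lemma two_pow_mul_pairCount {n : ℕ} (A B : Finset (Fin n → ℤˣ)) :
    2 ^ n * pairCount A B = ∑ S, (∑ z ∈ B, walsh S z) * walshWeight A S := by
  have h : ∀ S : Finset (Fin n), (∑ z ∈ B, walsh S z) * walshWeight A S =
      ∑ x ∈ A, ∑ y ∈ A, ∑ z ∈ B, walsh S (z * (x * y)) := by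
    intro S
    simp only [walsh_mul, ← sum_mul, ← mul_sum, walshWeight, sq]
  simp only [h]
  rw [sum_comm, pairCount, mul_sum]
  refine sum_congr rfl fun x _ => ?_
  rw [sum_comm, mul_sum]
  refine sum_congr rfl fun y _ => ?_
  rw [sum_comm]
  have hz : ∀ z : Fin n → ℤˣ, z * (x * y) = 1 ↔ x * y = z := by
    intro z
    constructor
    · intro h1
      calc x * y = z * z * (x * y) := by rw [cube_mul_self, one_mul]
        _ = z := by rw [mul_assoc, h1, mul_one]
    · rintro rfl
      exact cube_mul_self _
  simp only [sum_walsh_index, hz, sum_ite_eq, mul_ite, mul_one, mul_zero]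

lemma sum_walsh_mul_X_pow {n : ℕ} (S : Finset (Fin n)) :
    ∑ z : Fin n → ℤˣ, Polynomial.C (walsh S z) * Polynomial.X ^ hammingDist z 1 =
      ((1 - Polynomial.X) ^ S.card * (1 + Polynomial.X) ^ (n - S.card) : Polynomial ℤ) := by
  have hz : ∀ z : Fin n → ℤˣ,
      Polynomial.C (walsh S z) * (Polynomial.X : Polynomial ℤ) ^ hammingDist z 1 =
        ∏ i, ((if i ∈ S then Polynomial.C (z i : ℤ) else 1) *
          if z i = 1 then 1 else Polynomial.X) := by
    intro z
    rw [prod_mul_distrib, prod_ite_mem, univ_inter, walsh, map_prod]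
    congr 1
    rw [prod_ite]
    simp [hammingDist]
  simp only [hz]
  rw [← Fintype.prod_sum (fun i (u : ℤˣ) => (if i ∈ S then Polynomial.C (u : ℤ) else 1) *
      if u = 1 then 1 else (Polynomial.X : Polynomial ℤ))]
  have hi : ∀ i, ∑ u : ℤˣ, (if i ∈ S then Polynomial.C (u : ℤ) else 1) *
      (if u = 1 then 1 else (Polynomial.X : Polynomial ℤ)) =
        if i ∈ S then 1 - Polynomial.X else 1 + Polynomial.X := by
    intro i
    rw [UnitsInt.univ, sum_pair (by decide)]
    have hne : (-1 : ℤˣ) ≠ 1 := by decide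
    by_cases h : i ∈ S <;> simp [h, hne, sub_eq_add_neg]
  simp only [hi]
  rw [prod_ite]
  simp [filter_notMem_eq_sdiff, card_sdiff]

lemma sum_hSphere_walsh {n : ℕ} (S : Finset (Fin n)) (i : ℕ) :
    ∑ z ∈ hSphere n i, walsh S z = krawtchouk S.card (n - S.card) i := by
  rw [krawtchouk, ← sum_walsh_mul_X_pow, Polynomial.finsetSum_coeff, hSphere, sum_filter]
  refine sum_congr rfl fun z _ => ?_
  rw [Polynomial.coeff_C_mul_X_pow]
  simp only [eq_comm]

lemma sum_hBall_walsh {n : ℕ} (S : Finset (Fin n)) (r : ℕ) :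
    ∑ z ∈ hBall n r, walsh S z = ∑ i ∈ range (r + 1), krawtchouk S.card (n - S.card) i := by
  simp only [← sum_hSphere_walsh, hSphere, hBall, sum_filter]
  rw [sum_comm]
  refine sum_congr rfl fun z _ => ?_
  simp

lemma sum_hBall_walsh_empty (n r : ℕ) :
    ∑ z ∈ hBall n r, walsh ∅ z = ballBinom n r := by
  rw [sum_hBall_walsh]
  simp [krawtchouk_zero_left, ballBinom]

lemma sum_hBall_walsh_of_nonempty {n : ℕ} (S : Finset (Fin n)) (hS : S.Nonempty) (r : ℕ) :
    ∑ z ∈ hBall n r, walsh S z = krawtchouk (S.card - 1) (n - S.card) r := by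
  rw [sum_hBall_walsh]
  obtain ⟨k, hk⟩ : ∃ k, S.card = k + 1 := ⟨S.card - 1, by have := hS.card_pos; omega⟩
  rw [hk, sum_krawtchouk_succ_left, add_tsub_cancel_right]

lemma card_hBall (n r : ℕ) : (hBall n r).card = ballBinom n r := by
  have := sum_hBall_walsh_empty n r
  simp only [walsh, prod_empty, sum_const, nsmul_eq_mul, mul_one] at this
  exact_mod_cast this

lemma ballBinom_add_krawtchouk (m r : ℕ) :
    (ballBinom (m + 2) r : ℤ) + 2 * krawtchouk 0 (m + 1) r + krawtchouk 1 m r =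
      4 * ballBinom m r := by
  rw [← sum_krawtchouk_succ_left 0, ← sum_krawtchouk_succ_left 1, ballBinom, ballBinom]
  push_cast
  rw [mul_sum, mul_sum, ← sum_add_distrib, ← sum_add_distrib]
  refine sum_congr rfl fun i _ => ?_
  rw [← krawtchouk_subcube, krawtchouk_zero_left]

lemma BStab_indic (n r : ℕ) (A : Finset (Fin n → ℤˣ)) :
    BStab n r (indic n A) = (pairCount A (hBall n r) : ℝ) / (2 ^ n * ballBinom n r) := by
  rw [BStab, card_hBall]
  congr 1
  rw [pairCount]
  push_cast
  rw [← sum_filter_add_sum_filter_not univ (· ∈ A), filter_mem_eq_inter, univ_inter]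
  rw [sum_eq_zero (s := univ.filter fun x => x ∉ A), add_zero]
  · refine sum_congr rfl fun x hx => ?_
    have h1 : ∑ z ∈ hBall n r, indic n A x * indic n A (x * z) =
        ∑ z, if z ∈ hBall n r then indic n A (x * z) else 0 := by
      simp [indic, hx]
    have h2 : ∑ y ∈ A, (if x * y ∈ hBall n r then (1 : ℝ) else 0) =
        ∑ y, if x * y ∈ hBall n r then indic n A y else 0 := by
      rw [← sum_filter_add_sum_filter_not univ (· ∈ A), filter_mem_eq_inter, univ_inter,
        sum_eq_zero (s := univ.filter fun x => x ∉ A), add_zero]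
      · exact sum_congr rfl fun y hy => by simp [indic, hy]
      · intro y hy
        simp [indic, (mem_filter.mp hy).2]
    rw [h1, h2, ← Equiv.sum_comp (Equiv.mulLeft x)]
    refine sum_congr rfl fun y _ => ?_
    simp [← mul_assoc, cube_mul_self]
  · intro x hx
    simp [indic, (mem_filter.mp hx).2]

lemma walshWeight_nonneg {n : ℕ} (A : Finset (Fin n → ℤˣ)) (S : Finset (Fin n)) :
    0 ≤ walshWeight A S := sq_nonneg _

lemma walshWeight_empty {n : ℕ} (A : Finset (Fin n → ℤˣ)) : walshWeight A ∅ = A.card ^ 2 := by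
  simp [walshWeight, walsh]

lemma sum_walshWeight {n : ℕ} (A : Finset (Fin n → ℤˣ)) :
    ∑ S, walshWeight A S = 2 ^ n * A.card := by
  have h := two_pow_mul_pairCount A {1}
  have hp : pairCount A {1} = A.card := by
    have hxy : ∀ x y : Fin n → ℤˣ, x * y = 1 ↔ x = y := by
      intro x y
      constructor
      · intro h1
        calc x = x * (y * y) := by rw [cube_mul_self, mul_one]
          _ = y := by rw [← mul_assoc, h1, one_mul]
      · rintro rfl
        exact cube_mul_self _
    simp [pairCount, hxy]
  rw [hp] at h
  rw [h]
  simp [walsh]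

/-- Bounding a quadratic form in the Walsh weights of a set of density `1/4` by means of
a majorant `L₂ * D + (L₁ - L₂) * E` of its eigenvalues. -/
lemma sum_mul_walshWeight_le {m : ℕ} (A : Finset (Fin (m + 2) → ℤˣ)) (hA : A.card = 2 ^ m)
    (L E : Finset (Fin (m + 2)) → ℤ) (L₁ L₂ D : ℤ) (hD : 0 < D) (hL : L₂ ≤ L₁)
    (hLE : ∀ S, S.Nonempty → D * L S ≤ D * L₂ + (L₁ - L₂) * E S)
    (hE : ∑ S, E S * walshWeight A S ≤ (2 * D + E ∅) * 4 ^ m) :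
    ∑ S, L S * walshWeight A S ≤ (L ∅ + 2 * L₁ + L₂) * 4 ^ m := by
  have hsum := sum_walshWeight A
  have hcast : ((2 ^ m : ℕ) : ℤ) ^ 2 = 4 ^ m := by
    push_cast
    rw [← pow_mul, mul_comm, pow_mul]
    norm_num
  have h0 : walshWeight A ∅ = 4 ^ m := by rw [walshWeight_empty, hA, hcast]
  have htot : (2 : ℤ) ^ (m + 2) * (A.card : ℤ) = 4 * 4 ^ m := by
    rw [hA, ← hcast]
    push_cast
    ring
  rw [htot] at hsum
  rw [← add_sum_erase _ _ (mem_univ ∅), h0] at hsum hE ⊢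
  have hle : ∑ S ∈ univ.erase ∅, D * (L S * walshWeight A S) ≤
      ∑ S ∈ univ.erase ∅, (D * L₂ * walshWeight A S + (L₁ - L₂) * (E S * walshWeight A S)) := by
    refine sum_le_sum fun S hS => ?_
    have := mul_le_mul_of_nonneg_right
      (hLE S (nonempty_iff_ne_empty.mpr (ne_of_mem_erase hS))) (walshWeight_nonneg A S)
    linarith
  rw [sum_add_distrib, ← mul_sum, ← mul_sum, ← mul_sum] at hle
  have hE' := mul_le_mul_of_nonneg_left hE (sub_nonneg.mpr hL)
  have hs : ∑ S ∈ univ.erase ∅, walshWeight A S = 3 * 4 ^ m := by linarith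
  rw [hs] at hle
  refine le_of_mul_le_mul_left ?_ hD
  linarith

lemma krawtchouk_one_le_zero (m r : ℕ) : krawtchouk 1 m r ≤ krawtchouk 0 (m + 1) r := by
  cases r with
  | zero => simp [krawtchouk_zero]
  | succ r =>
    rw [show (1 : ℕ) = 0 + 1 from rfl, krawtchouk_succ_left, krawtchouk_succ_right]
    have : 0 ≤ krawtchouk 0 m r := by simp [krawtchouk_zero_left]
    linarith

lemma sum_neg_one_pow_mul_walshWeight_nonneg {n : ℕ} (A : Finset (Fin n → ℤˣ)) :
    0 ≤ ∑ S, (-1) ^ S.card * walshWeight A S := by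
  have h := two_pow_mul_pairCount A (hSphere n n)
  have hS : ∀ S : Finset (Fin n), ∑ z ∈ hSphere n n, walsh S z = (-1) ^ S.card := by
    intro S
    have hc : S.card ≤ n := card_finset_fin_le S
    rw [sum_hSphere_walsh, krawtchouk_reflect _ _ 0 n (by omega), krawtchouk_zero, mul_one]
  simp only [hS] at h
  rw [← h]
  exact mul_nonneg (by positivity) (pairCount_nonneg _ _)

lemma sum_neg_one_pow_mul_linear_mul_walshWeight_nonneg {n : ℕ}
    (A : Finset (Fin (n + 1) → ℤˣ)) :
    0 ≤ ∑ S, (-1) ^ S.card * (n + 2 - 2 * S.card : ℤ) * walshWeight A S := by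
  have h := two_pow_mul_pairCount A (hSphere (n + 1) n)
  have hS : ∀ S : Finset (Fin (n + 1)), ∑ z ∈ hSphere (n + 1) n, walsh S z =
      (-1) ^ S.card * (n + 1 - 2 * S.card : ℤ) := by
    intro S
    have hc : S.card ≤ n + 1 := card_finset_fin_le S
    rw [sum_hSphere_walsh, krawtchouk_reflect _ _ 1 n (by omega), krawtchouk_one]
    push_cast [hc]
    ring
  simp only [hS] at h
  have h1 := sum_neg_one_pow_mul_walshWeight_nonneg A
  have h2 : 0 ≤ (2 : ℤ) ^ (n + 1) * pairCount A (hSphere (n + 1) n) :=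
    mul_nonneg (by positivity) (pairCount_nonneg _ _)
  rw [h] at h2
  have h3 := add_nonneg h1 h2
  rw [← sum_add_distrib] at h3
  refine h3.trans_eq (sum_congr rfl fun S _ => ?_)
  ring

lemma pairCount_hBall_le {m r : ℕ} (hr : 1 ≤ r) (hrm : 2 * r ≤ m)
    (A : Finset (Fin (m + 2) → ℤˣ)) (hA : A.card = 2 ^ m) :
    pairCount A (hBall (m + 2) r) ≤ 2 ^ m * ballBinom m r := by
  have htotal : ∑ S, walshWeight A S = 4 * 4 ^ m := by
    rw [sum_walshWeight, hA, show (4 : ℤ) = 2 * 2 by norm_num, mul_pow]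
    push_cast
    ring
  have hL : krawtchouk 1 m r ≤ krawtchouk 0 (m + 1) r := krawtchouk_one_le_zero m r
  have habs : ∀ a b, a + b = m + 1 → 1 ≤ a → 1 ≤ b → |krawtchouk a b r| ≤ krawtchouk 1 m r :=
    abs_krawtchouk_le (m + 1) r (by omega)
  have hL₂ : 0 ≤ krawtchouk 1 m r :=
    (abs_nonneg _).trans (habs 1 m (by omega) le_rfl (by omega))
  have hfull : krawtchouk (m + 1) 0 r = (-1) ^ r * krawtchouk 0 (m + 1) r :=
    krawtchouk_swap 0 (m + 1) r
  have hcases : ∀ S : Finset (Fin (m + 2)), S.Nonempty →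
      (S.card = 1 ∧ ∑ z ∈ hBall (m + 2) r, walsh S z = krawtchouk 0 (m + 1) r) ∨
      (2 ≤ S.card ∧ S.card ≤ m + 1 ∧
        ∑ z ∈ hBall (m + 2) r, walsh S z ≤ krawtchouk 1 m r) ∨
      (S.card = m + 2 ∧
        ∑ z ∈ hBall (m + 2) r, walsh S z = (-1) ^ r * krawtchouk 0 (m + 1) r) := by
    intro S hS
    have hpos := hS.card_pos
    have hle : S.card ≤ m + 2 := card_finset_fin_le S
    rw [sum_hBall_walsh_of_nonempty S hS]
    by_cases h1 : S.card = 1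
    · left
      simp [h1]
    by_cases h2 : S.card = m + 2
    · right; right
      simp [h2, hfull]
    · right; left
      exact ⟨by omega, by omega,
        (le_abs_self _).trans (habs _ _ (by omega) (by omega) (by omega))⟩
  have hmain : ∑ S, (∑ z ∈ hBall (m + 2) r, walsh S z) * walshWeight A S ≤
      (∑ z ∈ hBall (m + 2) r, walsh ∅ z + 2 * krawtchouk 0 (m + 1) r + krawtchouk 1 m r) *
        4 ^ m := by
    by_cases hpar : Even r ∧ Even m
    · obtain ⟨hre, hme⟩ := hpar
      refine sum_mul_walshWeight_le A hA _
        (fun S => (m - 1 : ℤ) - (-1) ^ S.card * (m + 3 - 2 * S.card)) _ _ (2 * m)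
        (by omega) hL ?_ ?_
      · intro S hS
        rcases hcases S hS with ⟨hk, hl⟩ | ⟨hk1, hk2, hl⟩ | ⟨hk, hl⟩
        · rw [hl, hk]
          push_cast
          linarith
        · have hE : 0 ≤ (m - 1 : ℤ) - (-1) ^ S.card * (m + 3 - 2 * S.card) := by
            rcases neg_one_pow_eq_or ℤ S.card with h | h <;> rw [h] <;> omega
          have h1 := mul_le_mul_of_nonneg_left hl (by omega : (0 : ℤ) ≤ 2 * m)
          have h2 := mul_nonneg (sub_nonneg.mpr hL) hE
          linarith
        · rw [hl, hk, hre.neg_one_pow, (hme.add even_two).neg_one_pow]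
          push_cast
          linarith
      · have h := sum_neg_one_pow_mul_linear_mul_walshWeight_nonneg A
        simp only [sub_mul, sum_sub_distrib, ← mul_sum, htotal] at h ⊢
        push_cast at h
        simp only [card_empty]
        have h3 : ∑ S : Finset (Fin (m + 2)),
            (-1) ^ S.card * ((m : ℤ) + 1 + 2 - 2 * S.card) * walshWeight A S =
            ∑ S : Finset (Fin (m + 2)),
              (-1) ^ S.card * ((m : ℤ) + 3 - 2 * S.card) * walshWeight A S :=
          sum_congr rfl fun S _ => by ring
        rw [h3] at h
        push_cast
        linarith
    · refine sum_mul_walshWeight_le A hA _ (fun S => 1 - (-1) ^ S.card) _ _ 2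
        (by norm_num) hL ?_ ?_
      · intro S hS
        have hE : 0 ≤ 1 - (-1 : ℤ) ^ S.card := by
          rcases neg_one_pow_eq_or ℤ S.card with h | h <;> rw [h] <;> norm_num
        have h2 := mul_nonneg (sub_nonneg.mpr hL) hE
        rcases hcases S hS with ⟨hk, hl⟩ | ⟨hk1, hk2, hl⟩ | ⟨hk, hl⟩
        · rw [hl, hk]
          linarith
        · linarith
        · rw [hl]
          rcases Nat.even_or_odd r with hre | hro
          · have hmo : Odd m := Nat.not_even_iff_odd.mp fun h => hpar ⟨hre, h⟩
            rw [hk, hre.neg_one_pow, (hmo.add_even even_two).neg_one_pow]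
            linarith
          · rw [hro.neg_one_pow]
            linarith
      · have h := sum_neg_one_pow_mul_walshWeight_nonneg A
        simp only [sub_mul, one_mul, sum_sub_distrib, htotal]
        simp only [card_empty, pow_zero]
        linarith
  rw [← two_pow_mul_pairCount, sum_hBall_walsh_empty, ballBinom_add_krawtchouk] at hmain
  refine le_of_mul_le_mul_left (hmain.trans_eq ?_) (by positivity : (0 : ℤ) < 2 ^ (m + 2))
  rw [show (4 : ℤ) = 2 * 2 by norm_num, mul_pow]
  ring

/-- The subcube of codimension two on which the first two coordinates equal `1`. -/
def quarterCube (m : ℕ) : Finset (Fin (m + 2) → ℤˣ) :=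
  univ.filter fun x => x 0 = 1 ∧ x 1 = 1

lemma four_mul_ite_mem_quarterCube {m : ℕ} (z : Fin (m + 2) → ℤˣ) :
    4 * (if z ∈ quarterCube m then 1 else 0 : ℤ) =
      walsh ∅ z + walsh {0} z + walsh {1} z + walsh {0, 1} z := by
  have h01 : (0 : Fin (m + 2)) ≠ 1 := by simp
  simp only [walsh, prod_empty, prod_singleton, prod_pair h01, quarterCube, mem_filter, mem_univ,
    true_and]
  rcases Int.units_eq_one_or (z 0) with h0 | h0 <;>
    rcases Int.units_eq_one_or (z 1) with h1 | h1 <;>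
    simp [h0, h1]

lemma sum_hBall_ite_mem_quarterCube (m r : ℕ) :
    ∑ z ∈ hBall (m + 2) r, (if z ∈ quarterCube m then 1 else 0 : ℤ) = ballBinom m r := by
  have h01 : (0 : Fin (m + 2)) ≠ 1 := by simp
  have h : 4 * ∑ z ∈ hBall (m + 2) r, (if z ∈ quarterCube m then 1 else 0 : ℤ) =
      4 * ballBinom m r := by
    rw [mul_sum]
    simp only [four_mul_ite_mem_quarterCube, sum_add_distrib]
    rw [sum_hBall_walsh_empty, sum_hBall_walsh_of_nonempty _ (by simp),
      sum_hBall_walsh_of_nonempty _ (by simp), sum_hBall_walsh_of_nonempty _ (by simp),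
      card_pair h01, ← ballBinom_add_krawtchouk]
    simp only [card_singleton, Nat.add_sub_cancel, Nat.sub_self,
      show m + 2 - 1 = m + 1 by omega, show 2 - 1 = 1 by omega]
    ring
  linarith

lemma card_quarterCube (m : ℕ) : (quarterCube m).card = 2 ^ m := by
  have h := sum_hBall_ite_mem_quarterCube m (m + 2)
  have hball : hBall (m + 2) (m + 2) = univ := by
    refine filter_true_of_mem fun z _ => ?_
    simpa using hammingDist_le_card_fintype (x := z) (y := 1)
  have hbinom : ballBinom m (m + 2) = 2 ^ m := by
    rw [ballBinom, sum_range_succ, sum_range_succ, Nat.sum_range_choose]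
    simp [Nat.choose_eq_zero_of_lt]
  rw [hball, hbinom, sum_boole, filter_mem_eq_inter, univ_inter] at h
  exact_mod_cast h

lemma pairCount_quarterCube (m r : ℕ) :
    pairCount (quarterCube m) (hBall (m + 2) r) = 2 ^ m * ballBinom m r := by
  rw [pairCount]
  have h : ∀ x ∈ quarterCube m,
      ∑ y ∈ quarterCube m, (if x * y ∈ hBall (m + 2) r then 1 else 0 : ℤ) = ballBinom m r := by
    intro x hx
    have hmul : ∀ y, x * y ∈ quarterCube m ↔ y ∈ quarterCube m := by
      intro y
      simp only [quarterCube, mem_filter, mem_univ, true_and] at hx ⊢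
      simp [hx.1, hx.2]
    rw [← sum_hBall_ite_mem_quarterCube, sum_boole, sum_boole]
    congr 1
    refine card_bij (fun y _ => x * y) ?_ (fun _ _ _ _ h => mul_left_cancel h) ?_
    · intro y hy
      rw [mem_filter] at hy ⊢
      exact ⟨hy.2, (hmul y).mpr hy.1⟩
    · intro z hz
      rw [mem_filter] at hz
      have hxz : x * (x * z) = z := by rw [← mul_assoc, cube_mul_self, one_mul]
      refine ⟨x * z, ?_, hxz⟩
      rw [mem_filter, hxz]
      exact ⟨(hmul z).mpr hz.2, hz.1⟩
  rw [sum_congr rfl h, sum_const, card_quarterCube, nsmul_eq_mul]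
  push_cast
  rfl

/-- for `n ≥ 2` and `1 ≤ r ≤ n/2 − 1`,
`Γ_B^(n)(2^{n−2}, r) = C(n−2,≤r) / (4·C(n,≤r))`. -/
theorem gammaB_quarter (n r : ℕ) (hn : 2 ≤ n) (hr1 : 1 ≤ r)
    (hr2 : (r : ℝ) ≤ (n : ℝ) / 2 - 1) :
    GammaB n (2 ^ (n - 2)) r = (ballBinom (n - 2) r : ℝ) / (4 * (ballBinom n r : ℝ)) := by
  obtain ⟨m, rfl⟩ : ∃ m, n = m + 2 := ⟨n - 2, by omega⟩
  have hrm : 2 * r ≤ m := by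
    push_cast at hr2
    have h : (2 : ℝ) * r ≤ m := by linarith
    exact_mod_cast h
  rw [add_tsub_cancel_right]
  have hvalue : (ballBinom m r : ℝ) / (4 * ballBinom (m + 2) r) =
      ((2 ^ m * ballBinom m r : ℤ) : ℝ) / (2 ^ (m + 2) * ballBinom (m + 2) r) := by
    push_cast
    rw [show (2 : ℝ) ^ (m + 2) * ballBinom (m + 2) r = 2 ^ m * (4 * ballBinom (m + 2) r) by ring,
      mul_div_mul_left _ _ (by positivity)]
  rw [hvalue]
  refine IsGreatest.csSup_eq ⟨⟨quarterCube m, card_quarterCube m, ?_⟩, ?_⟩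
  · rw [BStab_indic, pairCount_quarterCube]
  · rintro y ⟨A, hA, rfl⟩
    rw [BStab_indic]
    exact div_le_div_of_nonneg_right (Int.cast_le.mpr (pairCount_hBall_le hr1 hrm A hA))
      (by positivity)
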